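/- Let C and D ≠ 0 be constants, and define φ(r,s) := D/(√(C − r² + s²)·(√(C − r² + s²) − s)²) on the region where r > 0, C − r² + s² > 0, √(C − r² + s²) − s > 0, and φ > 0. Then φ satisfies both: (i) φ_r − s·φ_{rs} − r·φ_{ss} = 0, and (ii) ψ² − (s·ψ_r + r·ψ_s)/r = 0, where ψ := (s·φ_r + r·φ_s)/(2rφ). (Hence the corresponding spherically symmetric metric is projectively flat with zero flag curvature; these are Berwald metrics.) -/

import Mathlib

open Real

/-- Partial derivative in the first variable. -/
noncomputable def pd1 (f : ℝ → ℝ → ℝ) (r s : ℝ) : ℝ := deriv (fun t => f t s) r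

/-- Partial derivative in the second variable. -/
noncomputable def pd2 (f : ℝ → ℝ → ℝ) (r s : ℝ) : ℝ := deriv (fun t => f r t) s

/-- ψ := (s·φ_r + r·φ_s)/(2rφ). -/
noncomputable def psiFun (φ : ℝ → ℝ → ℝ) (r s : ℝ) : ℝ :=
  (s * pd1 φ r s + r * pd2 φ r s) / (2 * r * φ r s)

/-- Solution 1 of the Shen–Yu classification (K = 0, D ≠ 0):
φ = D/(√(C − r² + s²)·(√(C − r² + s²) − s)²). -/
noncomputable def berwaldSolPhi (C D : ℝ) : ℝ → ℝ → ℝ :=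
  fun r s => D / (Real.sqrt (C - r ^ 2 + s ^ 2) *
    (Real.sqrt (C - r ^ 2 + s ^ 2) - s) ^ 2)

open Filter Topology

section PartialDerivatives

variable {C r s : ℝ}

lemma hasDerivAt_sqrt_fst (h : 0 < C - r ^ 2 + s ^ 2) :
    HasDerivAt (fun t => √(C - t ^ 2 + s ^ 2)) (-r / √(C - r ^ 2 + s ^ 2)) r := by
  have h1 : HasDerivAt (fun t : ℝ => C - t ^ 2 + s ^ 2) (-(2 * r)) r := by
    simpa using (((hasDerivAt_id r).pow 2).const_sub C).add_const (s ^ 2)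
  convert h1.sqrt h.ne' using 1
  field_simp

lemma hasDerivAt_sqrt_snd (h : 0 < C - r ^ 2 + s ^ 2) :
    HasDerivAt (fun t => √(C - r ^ 2 + t ^ 2)) (s / √(C - r ^ 2 + s ^ 2)) s := by
  have h1 : HasDerivAt (fun t : ℝ => C - r ^ 2 + t ^ 2) (2 * s) s := by
    simpa using ((hasDerivAt_id s).pow 2).const_add (C - r ^ 2)
  convert h1.sqrt h.ne' using 1
  field_simp

/-- Near a point of the domain of the solution, every point of the horizontal line through it
lies in the domain. -/
lemma eventually_domain_fst (hr : 0 < r) (h : 0 < C - r ^ 2 + s ^ 2)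
    (hs : 0 < √(C - r ^ 2 + s ^ 2) - s) :
    ∀ᶠ t in 𝓝 r, 0 < t ∧ 0 < C - t ^ 2 + s ^ 2 ∧ 0 < √(C - t ^ 2 + s ^ 2) - s := by
  have h1 : Continuous fun t : ℝ => C - t ^ 2 + s ^ 2 := by fun_prop
  have h2 : Continuous fun t : ℝ => √(C - t ^ 2 + s ^ 2) - s := by fun_prop
  exact (lt_mem_nhds hr).and ((h1.continuousAt.eventually (lt_mem_nhds h)).and
    (h2.continuousAt.eventually (lt_mem_nhds hs)))

/-- Near a point of the domain of the solution, every point of the vertical line through it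
lies in the domain. -/
lemma eventually_domain_snd (h : 0 < C - r ^ 2 + s ^ 2) (hs : 0 < √(C - r ^ 2 + s ^ 2) - s) :
    ∀ᶠ t in 𝓝 s, 0 < C - r ^ 2 + t ^ 2 ∧ 0 < √(C - r ^ 2 + t ^ 2) - t := by
  have h1 : Continuous fun t : ℝ => C - r ^ 2 + t ^ 2 := by fun_prop
  have h2 : Continuous fun t : ℝ => √(C - r ^ 2 + t ^ 2) - t := by fun_prop
  exact (h1.continuousAt.eventually (lt_mem_nhds h)).and
    (h2.continuousAt.eventually (lt_mem_nhds hs))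

lemma pd1_berwaldSolPhi (D : ℝ) (h : 0 < C - r ^ 2 + s ^ 2)
    (hs : 0 < √(C - r ^ 2 + s ^ 2) - s) :
    pd1 (berwaldSolPhi C D) r s = D * r * (3 * √(C - r ^ 2 + s ^ 2) - s) /
      (√(C - r ^ 2 + s ^ 2) ^ 3 * (√(C - r ^ 2 + s ^ 2) - s) ^ 3) := by
  have hQ := Real.sqrt_pos.2 h
  have hd := hasDerivAt_sqrt_fst h
  have := (hasDerivAt_const r D).fun_div (hd.fun_mul ((hd.sub_const s).fun_pow 2))
    (mul_pos hQ (pow_pos hs 2)).ne'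
  simp only [pd1, berwaldSolPhi]
  rw [this.deriv]
  generalize √(C - r ^ 2 + s ^ 2) = Q at *
  have hs' := hs.ne'
  field_simp
  ring

lemma pd2_berwaldSolPhi (D : ℝ) (h : 0 < C - r ^ 2 + s ^ 2)
    (hs : 0 < √(C - r ^ 2 + s ^ 2) - s) :
    pd2 (berwaldSolPhi C D) r s = D * (2 * √(C - r ^ 2 + s ^ 2) - s) /
      (√(C - r ^ 2 + s ^ 2) ^ 3 * (√(C - r ^ 2 + s ^ 2) - s) ^ 2) := by
  have hQ := Real.sqrt_pos.2 h
  have hd := hasDerivAt_sqrt_snd h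
  have := (hasDerivAt_const s D).fun_div
    (hd.fun_mul ((hd.fun_sub (hasDerivAt_id' s)).fun_pow 2)) (mul_pos hQ (pow_pos hs 2)).ne'
  simp only [pd2, berwaldSolPhi]
  rw [this.deriv]
  generalize √(C - r ^ 2 + s ^ 2) = Q at *
  have hs' := hs.ne'
  field_simp
  ring

lemma psiFun_berwaldSolPhi {D : ℝ} (hD : D ≠ 0) (hr : 0 < r) (h : 0 < C - r ^ 2 + s ^ 2)
    (hs : 0 < √(C - r ^ 2 + s ^ 2) - s) :
    psiFun (berwaldSolPhi C D) r s = 1 / (√(C - r ^ 2 + s ^ 2) - s) := by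
  have hQ := Real.sqrt_pos.2 h
  rw [psiFun, pd1_berwaldSolPhi D h hs, pd2_berwaldSolPhi D h hs, berwaldSolPhi]
  generalize √(C - r ^ 2 + s ^ 2) = Q at *
  have hs' := hs.ne'
  field_simp
  ring

end PartialDerivatives

theorem berwaldSol_satisfies_PDEs (C D : ℝ) (hD : D ≠ 0) :
    ∀ r s : ℝ, 0 < r → 0 < C - r ^ 2 + s ^ 2 → 0 < Real.sqrt (C - r ^ 2 + s ^ 2) - s →
      0 < berwaldSolPhi C D r s →
      (pd1 (berwaldSolPhi C D) r s - s * pd1 (pd2 (berwaldSolPhi C D)) r s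
        - r * pd2 (pd2 (berwaldSolPhi C D)) r s = 0) ∧
      ((psiFun (berwaldSolPhi C D) r s) ^ 2
        - (s * pd1 (psiFun (berwaldSolPhi C D)) r s
          + r * pd2 (psiFun (berwaldSolPhi C D)) r s) / r = 0) := by
  intro r s hr h hs _
  have hQ := Real.sqrt_pos.2 h
  have hd₁ := hasDerivAt_sqrt_fst h
  have hd₂ := hasDerivAt_sqrt_snd h
  have hid := hasDerivAt_id' s
  have ev₁ := eventually_domain_fst hr h hs
  have ev₂ := eventually_domain_snd h hs
  constructor
  · have e₁ : pd1 (pd2 (berwaldSolPhi C D)) r s = _ :=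
      (EventuallyEq.deriv_eq (ev₁.mono fun t ht => pd2_berwaldSolPhi D ht.2.1 ht.2.2)).trans
        ((((hd₁.const_mul 2).sub_const s).const_mul D).fun_div
          ((hd₁.fun_pow 3).fun_mul ((hd₁.sub_const s).fun_pow 2))
          (mul_pos (pow_pos hQ 3) (pow_pos hs 2)).ne').deriv
    have e₂ : pd2 (pd2 (berwaldSolPhi C D)) r s = _ :=
      (EventuallyEq.deriv_eq (ev₂.mono fun t ht => pd2_berwaldSolPhi D ht.1 ht.2)).trans
        ((((hd₂.const_mul 2).fun_sub hid).const_mul D).fun_div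
          ((hd₂.fun_pow 3).fun_mul ((hd₂.fun_sub hid).fun_pow 2))
          (mul_pos (pow_pos hQ 3) (pow_pos hs 2)).ne').deriv
    rw [pd1_berwaldSolPhi D h hs, e₁, e₂]
    generalize √(C - r ^ 2 + s ^ 2) = Q at *
    have hs' := hs.ne'
    field_simp
    ring
  · have e₁ : pd1 (psiFun (berwaldSolPhi C D)) r s = _ :=
      (EventuallyEq.deriv_eq
        (ev₁.mono fun t ht => psiFun_berwaldSolPhi hD ht.1 ht.2.1 ht.2.2)).trans
        ((hasDerivAt_const r (1 : ℝ)).fun_div (hd₁.sub_const s) hs.ne').deriv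
    have e₂ : pd2 (psiFun (berwaldSolPhi C D)) r s = _ :=
      (EventuallyEq.deriv_eq (ev₂.mono fun t ht => psiFun_berwaldSolPhi hD hr ht.1 ht.2)).trans
        ((hasDerivAt_const s (1 : ℝ)).fun_div (hd₂.fun_sub hid) hs.ne').deriv
    rw [psiFun_berwaldSolPhi hD hr h hs, e₁, e₂]
    generalize √(C - r ^ 2 + s ^ 2) = Q at *
    have hs' := hs.ne'
    field_simp
    ring
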